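/- Let λ, c > 0, t > 0 and 0 ≤ x < ct. Then ∫₀^{x} q_{λ,c}(y,t) dy = 1 − ( √((ct−x)/(ct+x)) I₁((λ/c)√(c²t²−x²)) + I₀((λ/c)√(c²t²−x²)) ) / ( I₀(λt)+I₁(λt) ); that is, the distribution function of the telegraph meander at its end time t equals 1 − [ √((ct−x)/(ct+x)) I₁((λ/c)√(c²t²−x²)) + I₀((λ/c)√(c²t²−x²)) ] / (I₀(λt)+I₁(λt)) for 0 ≤ x < ct. -/

import Mathlib

open Real intervalIntegral

/-- Modified Bessel function of the first kind,
`I_ν(x) = ∑_{k≥0} (x/2)^{2k+ν} / (k! Γ(ν+k+1))`. -/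
noncomputable def besselI (ν x : ℝ) : ℝ :=
  ∑' k : ℕ, (x / 2) ^ (2 * (k : ℝ) + ν) / ((k.factorial : ℝ) * Real.Gamma (ν + k + 1))

/-- Absolutely continuous component of the law of the telegraph meander at its end time. -/
noncomputable def qdens (lam c x t : ℝ) : ℝ :=
  (1 / (besselI 0 (lam * t) + besselI 1 (lam * t))) *
    (lam * x * besselI 0 (lam / c * Real.sqrt (c ^ 2 * t ^ 2 - x ^ 2)) / (c * (c * t + x))
      + besselI 1 (lam / c * Real.sqrt (c ^ 2 * t ^ 2 - x ^ 2))
          / Real.sqrt (c ^ 2 * t ^ 2 - x ^ 2)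
          * (lam * x / c + (c * t - x) / (c * t + x)))

/-- A power series whose coefficients are dominated by those of `exp` is summable everywhere. -/
lemma summable_mul_pow_of_abs_le_inv_factorial {a : ℕ → ℝ}
    (ha : ∀ k, |a k| ≤ 1 / (k.factorial : ℝ)) (w : ℝ) :
    Summable fun k => a k * w ^ k := by
  refine Summable.of_norm_bounded (Real.summable_pow_div_factorial |w|) fun k => ?_
  rw [Real.norm_eq_abs, abs_mul, abs_pow]
  calc |a k| * |w| ^ k ≤ 1 / (k.factorial : ℝ) * |w| ^ k := by gcongr; exact ha k
    _ = |w| ^ k / k.factorial := by ring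

/-- Termwise differentiation of a power series dominated by `exp`. -/
lemma hasDerivAt_tsum_mul_pow {a : ℕ → ℝ}
    (ha : ∀ k, |a k| ≤ 1 / (k.factorial : ℝ)) (w : ℝ) :
    HasDerivAt (fun w => ∑' k, a k * w ^ k) (∑' k : ℕ, ((k + 1) * a (k + 1)) * w ^ k) w := by
  set R := |w| + 1 with hR
  have hR0 : 0 < R := by positivity
  have hw : w ∈ Metric.ball (0 : ℝ) R := by simp [hR]
  have hu : Summable fun k : ℕ => (k : ℝ) * (R ^ (k - 1) / k.factorial) := by
    rw [← summable_nat_add_iff 1]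
    refine (Real.summable_pow_div_factorial R).congr fun k => ?_
    rw [Nat.factorial_succ]
    push_cast
    field_simp
  have hbound : ∀ (k : ℕ) (y : ℝ), y ∈ Metric.ball (0 : ℝ) R →
      ‖a k * (k * y ^ (k - 1))‖ ≤ (k : ℝ) * (R ^ (k - 1) / k.factorial) := by
    intro k y hy
    have hy : |y| ≤ R := by simpa using (mem_ball_zero_iff.mp hy).le
    rw [Real.norm_eq_abs, abs_mul, abs_mul, abs_pow, Nat.abs_cast]
    calc |a k| * (k * |y| ^ (k - 1)) ≤ 1 / (k.factorial : ℝ) * (k * R ^ (k - 1)) := by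
          gcongr
          exact ha k
      _ = _ := by ring
  have h := hasDerivAt_tsum_of_isPreconnected (g := fun k w => a k * w ^ k)
    (g' := fun k w => a k * (k * w ^ (k - 1))) hu Metric.isOpen_ball
    (convex_ball (0 : ℝ) R).isPreconnected
    (fun k y _ => (hasDerivAt_pow k y).const_mul (a k)) hbound hw
    (summable_mul_pow_of_abs_le_inv_factorial ha w) hw
  refine h.congr_deriv ?_
  have hs : Summable fun k : ℕ => a k * (k * w ^ (k - 1)) :=
    Summable.of_norm_bounded hu fun k => hbound k w hw
  rw [hs.tsum_eq_zero_add]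
  simp only [Nat.cast_zero, zero_mul, mul_zero, zero_add, Nat.add_sub_cancel]
  refine tsum_congr fun k => ?_
  push_cast
  ring

/-- The entire function with `I₀(z) = besselZero (z² / 4)`. -/
noncomputable def besselZero (w : ℝ) : ℝ := ∑' k : ℕ, (1 / (k.factorial : ℝ) ^ 2) * w ^ k

/-- The entire function with `I₁(z) = (z / 2) * besselOne (z² / 4)`. -/
noncomputable def besselOne (w : ℝ) : ℝ :=
  ∑' k : ℕ, (1 / ((k.factorial : ℝ) * (k + 1).factorial)) * w ^ k

lemma one_le_factorial_cast (k : ℕ) : (1 : ℝ) ≤ k.factorial := by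
  exact_mod_cast Nat.one_le_iff_ne_zero.mpr k.factorial_ne_zero

lemma abs_one_div_factorial_sq_le (k : ℕ) :
    |1 / (k.factorial : ℝ) ^ 2| ≤ 1 / (k.factorial : ℝ) := by
  have h := one_le_factorial_cast k
  rw [abs_of_nonneg (by positivity)]
  gcongr
  nlinarith

lemma abs_one_div_factorial_mul_le (k : ℕ) :
    |1 / ((k.factorial : ℝ) * (k + 1).factorial)| ≤ 1 / (k.factorial : ℝ) := by
  have h := one_le_factorial_cast (k + 1)
  have h' := one_le_factorial_cast k
  rw [abs_of_nonneg (by positivity)]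
  gcongr
  nlinarith

lemma abs_div_factorial_sq_le (k : ℕ) :
    |(k : ℝ) / (k.factorial : ℝ) ^ 2| ≤ 1 / (k.factorial : ℝ) := by
  have h := one_le_factorial_cast k
  have hk : (k : ℝ) ≤ k.factorial := by exact_mod_cast Nat.self_le_factorial k
  rw [abs_of_nonneg (by positivity), div_le_div_iff₀ (by positivity) (by positivity)]
  nlinarith

lemma hasDerivAt_besselZero (w : ℝ) : HasDerivAt besselZero (besselOne w) w := by
  refine (hasDerivAt_tsum_mul_pow abs_one_div_factorial_sq_le w).congr_deriv ?_
  refine tsum_congr fun k => ?_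
  rw [Nat.factorial_succ]
  push_cast
  field_simp

lemma hasDerivAt_mul_besselOne (w : ℝ) :
    HasDerivAt (fun w => w * besselOne w) (besselZero w) w := by
  have h := hasDerivAt_tsum_mul_pow abs_div_factorial_sq_le w
  refine (h.congr_deriv (tsum_congr fun k => ?_)).congr_of_eventuallyEq
    (Filter.Eventually.of_forall fun v => ?_)
  · rw [Nat.factorial_succ]
    push_cast
    field_simp
  · simp only
    rw [(summable_mul_pow_of_abs_le_inv_factorial abs_div_factorial_sq_le v).tsum_eq_zero_add,
      besselOne, ← tsum_mul_left]
    simp only [Nat.cast_zero, zero_div, zero_mul, zero_add]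
    refine tsum_congr fun k => ?_
    rw [Nat.factorial_succ]
    push_cast
    field_simp
    ring

lemma continuous_besselZero : Continuous besselZero :=
  continuous_iff_continuousAt.mpr fun w => (hasDerivAt_besselZero w).continuousAt

lemma continuous_besselOne : Continuous besselOne :=
  continuous_iff_continuousAt.mpr fun w =>
    (hasDerivAt_tsum_mul_pow abs_one_div_factorial_mul_le w).continuousAt

lemma besselZero_pos {w : ℝ} (hw : 0 ≤ w) : 0 < besselZero w :=
  (summable_mul_pow_of_abs_le_inv_factorial abs_one_div_factorial_sq_le w).tsum_pos
    (fun k => by positivity) 0 (by simp)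

lemma besselOne_nonneg {w : ℝ} (hw : 0 ≤ w) : 0 ≤ besselOne w :=
  tsum_nonneg fun k => by positivity

lemma besselI_zero_eq (z : ℝ) : besselI 0 z = besselZero (z ^ 2 / 4) := by
  refine tsum_congr fun k => ?_
  have hpow : (z / 2) ^ (2 * (k : ℝ) + 0) = (z ^ 2 / 4) ^ k := by
    rw [show 2 * (k : ℝ) + 0 = ((2 * k : ℕ) : ℝ) by push_cast; ring, Real.rpow_natCast, pow_mul]
    congr 1
    ring
  rw [hpow, zero_add, Real.Gamma_nat_eq_factorial]
  ring

lemma besselI_one_eq (z : ℝ) :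
    besselI 1 z = z / 2 * besselOne (z ^ 2 / 4) := by
  rw [besselOne, ← tsum_mul_left]
  refine tsum_congr fun k => ?_
  have hpow : (z / 2) ^ (2 * (k : ℝ) + 1) = z / 2 * (z ^ 2 / 4) ^ k := by
    rw [show 2 * (k : ℝ) + 1 = ((2 * k + 1 : ℕ) : ℝ) by push_cast; ring, Real.rpow_natCast,
      pow_succ, pow_mul, show (z / 2) ^ 2 = z ^ 2 / 4 by ring]
    ring
  rw [hpow, show (1 : ℝ) + k + 1 = ((k + 1 : ℕ) : ℝ) + 1 by push_cast; ring,
    Real.Gamma_nat_eq_factorial]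
  ring

/-- Differentiating the numerator of the survival function of the telegraph meander. -/
lemma hasDerivAt_meander_survival {lam c a y : ℝ} (hlam : 0 < lam) (hc : 0 < c)
    (hy : 0 < a + y) :
    HasDerivAt
      (fun y => 2 * c / lam * (lam ^ 2 / (4 * c ^ 2) * (a ^ 2 - y ^ 2) *
          besselOne (lam ^ 2 / (4 * c ^ 2) * (a ^ 2 - y ^ 2))) / (a + y)
        + besselZero (lam ^ 2 / (4 * c ^ 2) * (a ^ 2 - y ^ 2)))
      (-(lam * y * besselZero (lam ^ 2 / (4 * c ^ 2) * (a ^ 2 - y ^ 2)) / (c * (a + y))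
        + lam / (2 * c) * besselOne (lam ^ 2 / (4 * c ^ 2) * (a ^ 2 - y ^ 2)) *
          (lam * y / c + (a - y) / (a + y)))) y := by
  have hw : HasDerivAt (fun y => lam ^ 2 / (4 * c ^ 2) * (a ^ 2 - y ^ 2))
      (lam ^ 2 / (4 * c ^ 2) * (-(2 * y))) y := by
    have h := ((hasDerivAt_pow 2 y).const_sub (a ^ 2)).const_mul (lam ^ 2 / (4 * c ^ 2))
    simpa using h
  have hA := (hasDerivAt_besselZero (lam ^ 2 / (4 * c ^ 2) * (a ^ 2 - y ^ 2))).comp y hw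
  have hB := (hasDerivAt_mul_besselOne (lam ^ 2 / (4 * c ^ 2) * (a ^ 2 - y ^ 2))).comp y hw
  have hd : HasDerivAt (fun y => a + y) 1 y := (hasDerivAt_id y).const_add a
  refine (((hB.const_mul (2 * c / lam)).div hd hy.ne').add hA).congr_deriv ?_
  simp only [Function.comp]
  generalize besselOne _ = B
  generalize besselZero _ = A
  field_simp
  ring

theorem stmt_18 (lam c t x : ℝ) (hlam : 0 < lam) (hc : 0 < c) (ht : 0 < t)
    (hx0 : 0 ≤ x) (hx : x < c * t) :
    ∫ y in (0:ℝ)..x, qdens lam c y t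
      = 1 - (Real.sqrt ((c * t - x) / (c * t + x)) *
              besselI 1 (lam / c * Real.sqrt (c ^ 2 * t ^ 2 - x ^ 2))
            + besselI 0 (lam / c * Real.sqrt (c ^ 2 * t ^ 2 - x ^ 2)))
          / (besselI 0 (lam * t) + besselI 1 (lam * t)) := by
  have hct : 0 < c * t := mul_pos hc ht
  set D := besselI 0 (lam * t) + besselI 1 (lam * t) with hD
  set k := lam ^ 2 / (4 * c ^ 2) with hk
  have hsq : ∀ {y : ℝ}, 0 ≤ y → y < c * t → 0 < c ^ 2 * t ^ 2 - y ^ 2 := fun h0 h1 => by nlinarith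
  have harg : ∀ {y : ℝ}, 0 ≤ y → y < c * t →
      (lam / c * √(c ^ 2 * t ^ 2 - y ^ 2)) ^ 2 / 4 = k * ((c * t) ^ 2 - y ^ 2) := by
    intro y h0 h1
    rw [mul_pow, Real.sq_sqrt (hsq h0 h1).le, hk]
    field_simp
  have hI0 : ∀ {y : ℝ}, 0 ≤ y → y < c * t → besselI 0 (lam / c * √(c ^ 2 * t ^ 2 - y ^ 2))
      = besselZero (k * ((c * t) ^ 2 - y ^ 2)) := by
    intro y h0 h1
    rw [besselI_zero_eq, harg h0 h1]
  have hI1 : ∀ {y : ℝ}, 0 ≤ y → y < c * t → besselI 1 (lam / c * √(c ^ 2 * t ^ 2 - y ^ 2))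
      = lam / c * √(c ^ 2 * t ^ 2 - y ^ 2) / 2 * besselOne (k * ((c * t) ^ 2 - y ^ 2)) := by
    intro y h0 h1
    rw [besselI_one_eq, harg h0 h1]
  set G : ℝ → ℝ := fun y => 2 * c / lam * (k * ((c * t) ^ 2 - y ^ 2) *
      besselOne (k * ((c * t) ^ 2 - y ^ 2))) / (c * t + y)
    + besselZero (k * ((c * t) ^ 2 - y ^ 2)) with hG
  have hGx : ∀ {y : ℝ}, 0 ≤ y → y < c * t →
      √((c * t - y) / (c * t + y)) * besselI 1 (lam / c * √(c ^ 2 * t ^ 2 - y ^ 2))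
        + besselI 0 (lam / c * √(c ^ 2 * t ^ 2 - y ^ 2)) = G y := by
    intro y h0 h1
    have hp : 0 < c * t + y := by linarith
    have hroot : √((c * t - y) / (c * t + y)) = √(c ^ 2 * t ^ 2 - y ^ 2) / (c * t + y) := by
      rw [show (c * t - y) / (c * t + y) = (c ^ 2 * t ^ 2 - y ^ 2) / (c * t + y) ^ 2 by
        field_simp; ring, Real.sqrt_div (hsq h0 h1).le, Real.sqrt_sq hp.le]
    rw [hI0 h0 h1, hI1 h0 h1, hroot, hG]
    have hs := Real.mul_self_sqrt (hsq h0 h1).le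
    set s := √(c ^ 2 * t ^ 2 - y ^ 2)
    have hss : (c * t) ^ 2 - y ^ 2 = s * s := by rw [hs]; ring
    simp only [hss]
    generalize besselOne _ = B
    rw [hk]
    field_simp
    ring
  have hG0 : G 0 = D := by
    rw [← hGx le_rfl hct, hD, show c ^ 2 * t ^ 2 - 0 ^ 2 = (c * t) ^ 2 by ring,
      Real.sqrt_sq hct.le, show lam / c * (c * t) = lam * t by field_simp, sub_zero, add_zero,
      div_self hct.ne', Real.sqrt_one]
    ring
  have hDpos : 0 < D := by
    rw [hD, besselI_zero_eq, besselI_one_eq]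
    have h0 := besselZero_pos (w := (lam * t) ^ 2 / 4) (by positivity)
    have h1 := besselOne_nonneg (w := (lam * t) ^ 2 / 4) (by positivity)
    positivity
  set g : ℝ → ℝ := fun y => lam * y * besselZero (k * ((c * t) ^ 2 - y ^ 2)) / (c * (c * t + y))
      + lam / (2 * c) * besselOne (k * ((c * t) ^ 2 - y ^ 2)) *
        (lam * y / c + (c * t - y) / (c * t + y)) with hg
  have hmem : ∀ {y : ℝ}, y ∈ Set.uIcc 0 x → 0 ≤ y ∧ y < c * t := by
    intro y hy
    rw [Set.uIcc_of_le hx0] at hy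
    exact ⟨hy.1, hy.2.trans_lt hx⟩
  have hq : ∀ y ∈ Set.uIcc 0 x, qdens lam c y t = -(1 / D) * -g y := by
    intro y hy
    obtain ⟨h0, h1⟩ := hmem hy
    have hs := Real.sqrt_pos.mpr (hsq h0 h1)
    rw [qdens, hI0 h0 h1, hI1 h0 h1, ← hD, neg_mul_neg, hg]
    congr 2
    field_simp
  have hcont : ContinuousOn (fun y => -g y) (Set.uIcc 0 x) := by
    have hA := continuous_besselZero
    have hB := continuous_besselOne
    have hne : ∀ y ∈ Set.uIcc 0 x, c * t + y ≠ 0 := fun y hy => by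
      have := (hmem hy).1
      positivity
    have hA' : Continuous fun y => besselZero (k * ((c * t) ^ 2 - y ^ 2)) := hA.comp (by fun_prop)
    have hB' : Continuous fun y => besselOne (k * ((c * t) ^ 2 - y ^ 2)) := hB.comp (by fun_prop)
    refine ContinuousOn.neg (ContinuousOn.add (ContinuousOn.div (by fun_prop) (by fun_prop)
      fun y hy => mul_ne_zero hc.ne' (hne y hy)) (ContinuousOn.mul (by fun_prop)
      (ContinuousOn.add (by fun_prop) (ContinuousOn.div (by fun_prop) (by fun_prop) hne))))
  rw [integral_congr hq, integral_const_mul, integral_eq_sub_of_hasDerivAt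
    (fun y hy => hasDerivAt_meander_survival (a := c * t) hlam hc
      (by linarith [(hmem hy).1])) hcont.intervalIntegrable, hGx hx0 hx]
  change -(1 / D) * (G x - G 0) = _
  rw [hG0]
  field_simp
  ring
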